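/- There exists a constant α > 0 (in fact any α < ln(e/2) works for all sufficiently large x) such that the number of integers 1 ≤ n ≤ x all of whose prime divisors are smaller than √x exceeds αx for all sufficiently large x. -/

import Mathlib

open scoped Classical

open Real in
theorem log_factorial_eq_sum_primesLE (n : ℕ) :
    log (n.factorial : ℝ) = ∑ p ∈ n.primesLE, (n.factorial.factorization p : ℝ) * log p := by
  have hsupp : n.factorial.primeFactors = n.primesLE := by
    ext p
    simp only [Nat.mem_primeFactors, Nat.mem_primesLE]
    constructor
    · rintro ⟨hp, hd, -⟩
      exact ⟨(hp.dvd_factorial).1 hd, hp⟩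
    · rintro ⟨hle, hp⟩
      exact ⟨hp, (hp.dvd_factorial).2 hle, n.factorial_ne_zero⟩
  conv_lhs => rw [← Nat.prod_factorization_pow_eq_self n.factorial_ne_zero]
  rw [Finsupp.prod, Nat.support_factorization, hsupp, Nat.cast_prod, log_prod]
  · exact Finset.sum_congr rfl fun p _ => by rw [Nat.cast_pow, log_pow]
  · intro p hp
    have := (Nat.prime_of_mem_primesLE hp).pos
    positivity

open Real in
theorem mul_log_sub_le_log_factorial {n : ℕ} (hn : 0 < n) :
    n * log n - n ≤ log (n.factorial : ℝ) := by
  have hn' : (0 : ℝ) < n := by exact_mod_cast hn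
  have hf : (0 : ℝ) < n.factorial := by exact_mod_cast n.factorial_pos
  have h := log_le_log (by positivity) (pow_div_factorial_le_exp (n : ℝ) hn'.le n)
  rw [log_div (by positivity) hf.ne', log_pow, log_exp] at h
  linarith

open Real in
theorem log_factorial_le_mul_log (n : ℕ) : log (n.factorial : ℝ) ≤ n * log n := by
  have hf : (0 : ℝ) < n.factorial := by exact_mod_cast n.factorial_pos
  rw [← log_pow]
  exact log_le_log hf (by exact_mod_cast n.factorial_le_pow)

theorem div_le_factorization_factorial {p : ℕ} (hp : p.Prime) (n : ℕ) :
    n / p ≤ n.factorial.factorization p := by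
  have h := Nat.factorization_factorial_mul hp (n := n / p)
  have hmono : (p * (n / p)).factorial.factorization p ≤ n.factorial.factorization p :=
    (Nat.factorization_le_iff_dvd (Nat.factorial_ne_zero _) (Nat.factorial_ne_zero _)).2
      (Nat.factorial_dvd_factorial (Nat.mul_div_le n p)) p
  omega

open Real in
/-- The upper half of Mertens' first theorem. -/
theorem sum_log_div_primesLE_le {n : ℕ} (hn : 0 < n) :
    ∑ p ∈ n.primesLE, log p / p ≤ log n + log 4 := by
  have hn' : (0 : ℝ) < n := by exact_mod_cast hn
  have hterm : ∀ p ∈ n.primesLE,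
      (n : ℝ) * (log p / p) ≤ (n.factorial.factorization p : ℝ) * log p + log p := by
    intro p hp
    have hpp := Nat.prime_of_mem_primesLE hp
    have hlog : 0 ≤ log (p : ℝ) := log_natCast_nonneg p
    have h1 : (n : ℝ) / p ≤ n.factorial.factorization p + 1 := by
      have h2 := Nat.lt_floor_add_one ((n : ℝ) / p)
      rw [Nat.floor_div_natCast, Nat.floor_natCast] at h2
      have h3 : ((n / p : ℕ) : ℝ) ≤ n.factorial.factorization p := by
        exact_mod_cast div_le_factorization_factorial hpp n
      linarith
    calc (n : ℝ) * (log p / p) = n / p * log p := by ring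
      _ ≤ (n.factorial.factorization p + 1) * log p := by gcongr
      _ = _ := by ring
  have hsum := Finset.sum_le_sum hterm
  rw [← Finset.mul_sum, Finset.sum_add_distrib, ← log_factorial_eq_sum_primesLE,
    ← Chebyshev.theta_eq_sum_primesLE_log] at hsum
  have htheta := Chebyshev.theta_le_log4_mul_x hn'.le
  have hfac := log_factorial_le_mul_log n
  refine le_of_mul_le_mul_left ?_ hn'
  linarith

open Real in
theorem log_mul_inv_sub_inv_le {n : ℕ} (hn : 2 ≤ n) :
    log n * (1 / ((n : ℝ) - 1) - 1 / n) ≤ 4 * (1 / (n : ℝ) ^ (3 / 2 : ℝ)) := by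
  have hn' : (2 : ℝ) ≤ n := by exact_mod_cast hn
  have h0 : (0 : ℝ) < n := by linarith
  have hlog : log (n : ℝ) ≤ 2 * (n : ℝ) ^ (1 / 2 : ℝ) := by
    have := log_le_rpow_div h0.le (show (0 : ℝ) < 1 / 2 by norm_num)
    linarith
  have hinv : 1 / ((n : ℝ) - 1) - 1 / n ≤ 2 / (n : ℝ) ^ 2 := by
    rw [div_sub_div _ _ (by linarith) h0.ne', div_le_div_iff₀ (by nlinarith) (by positivity)]
    nlinarith
  have hpow : (n : ℝ) ^ 2 = (n : ℝ) ^ (1 / 2 : ℝ) * (n : ℝ) ^ (3 / 2 : ℝ) := by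
    rw [← rpow_add h0, ← rpow_natCast]
    norm_num
  have hs : (0 : ℝ) < (n : ℝ) ^ (1 / 2 : ℝ) := by positivity
  calc log n * (1 / ((n : ℝ) - 1) - 1 / n)
      ≤ (2 * (n : ℝ) ^ (1 / 2 : ℝ)) * (2 / (n : ℝ) ^ 2) :=
        (mul_le_mul_of_nonneg_left hinv (log_natCast_nonneg n)).trans
          (mul_le_mul_of_nonneg_right hlog (by positivity))
    _ = 4 * (1 / (n : ℝ) ^ (3 / 2 : ℝ)) := by
        rw [hpow]
        field_simp
        norm_num

open Real in
/-- The lower half of Mertens' first theorem. -/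
theorem exists_log_sub_le_sum_log_div_primesLE :
    ∃ C : ℝ, ∀ n : ℕ, 0 < n → log n - C ≤ ∑ p ∈ n.primesLE, log p / p := by
  have hs : Summable fun n : ℕ => 1 / (n : ℝ) ^ (3 / 2 : ℝ) :=
    Real.summable_one_div_nat_rpow.2 (by norm_num)
  refine ⟨1 + 4 * ∑' n : ℕ, 1 / (n : ℝ) ^ (3 / 2 : ℝ), fun n hn => ?_⟩
  have hn' : (0 : ℝ) < n := by exact_mod_cast hn
  have hterm : ∀ p ∈ n.primesLE, (n.factorial.factorization p : ℝ) * log p ≤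
      n * (log p / p + 4 * (1 / (p : ℝ) ^ (3 / 2 : ℝ))) := by
    intro p hp
    have hpp := Nat.prime_of_mem_primesLE hp
    have h2 : (2 : ℝ) ≤ p := by exact_mod_cast hpp.two_le
    have h1 : (n.factorial.factorization p : ℝ) ≤ n / ((p : ℝ) - 1) := by
      have := Nat.factorization_factorial_le_div_pred hpp n
      calc (n.factorial.factorization p : ℝ) ≤ ((n / (p - 1) : ℕ) : ℝ) := by exact_mod_cast this
        _ ≤ (n : ℝ) / ((p - 1 : ℕ) : ℝ) := Nat.cast_div_le
        _ = _ := by rw [Nat.cast_sub hpp.one_le, Nat.cast_one]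
    calc (n.factorial.factorization p : ℝ) * log p
        ≤ n / ((p : ℝ) - 1) * log p := by gcongr
      _ = n * (log p / p + log p * (1 / ((p : ℝ) - 1) - 1 / p)) := by ring
      _ ≤ _ := mul_le_mul_of_nonneg_left
          (add_le_add_right (log_mul_inv_sub_inv_le hpp.two_le) _) hn'.le
  have hsum := Finset.sum_le_sum hterm
  rw [← log_factorial_eq_sum_primesLE, ← Finset.mul_sum, Finset.sum_add_distrib,
    ← Finset.mul_sum] at hsum
  have htail := hs.sum_le_tsum n.primesLE fun i _ => by positivity
  have hfac := mul_log_sub_le_log_factorial hn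
  refine le_of_mul_le_mul_left ?_ hn'
  have := mul_le_mul_of_nonneg_left htail hn'.le
  linarith

open Real in
theorem exists_sum_log_div_le_log_sub_log_add :
    ∃ C : ℝ, 0 ≤ C ∧ ∀ a b : ℝ, 2 ≤ a → a ≤ b →
      ∑ p ∈ (Nat.primesLE ⌊b⌋₊).filter (fun p : ℕ => a ≤ (p : ℝ)), log p / p ≤
        log b - log a + C := by
  obtain ⟨C, hC⟩ := exists_log_sub_le_sum_log_div_primesLE
  refine ⟨|C| + log 4 + log 2, by positivity, fun a b ha hab => ?_⟩
  have hceil : 2 ≤ ⌈a⌉₊ := by exact_mod_cast ha.trans (Nat.le_ceil a)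
  obtain ⟨m, hm⟩ : ∃ m, ⌈a⌉₊ = m + 1 := ⟨⌈a⌉₊ - 1, by omega⟩
  have hm0 : 0 < m := by omega
  have hma : a ≤ m + 1 := by
    have := Nat.le_ceil a
    rw [hm] at this
    exact_mod_cast this
  have hlow : log a - log 2 ≤ log m := by
    rw [← log_div (by linarith) two_ne_zero]
    exact log_le_log (by linarith) (by linarith)
  have hfloor : 0 < ⌊b⌋₊ := Nat.floor_pos.2 (by linarith)
  have hhigh : log (⌊b⌋₊ : ℝ) ≤ log b :=
    log_le_log (by exact_mod_cast hfloor) (Nat.floor_le (by linarith))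
  have hmb : m ≤ ⌊b⌋₊ := by
    refine Nat.le_floor ?_
    have : (m : ℝ) < a := Nat.lt_ceil.1 (by omega)
    linarith
  have hfilter : (Nat.primesLE ⌊b⌋₊).filter (fun p : ℕ => a ≤ (p : ℝ)) =
      Nat.primesLE ⌊b⌋₊ \ Nat.primesLE m := by
    ext p
    simp only [Finset.mem_filter, Finset.mem_sdiff, Nat.mem_primesLE, ← Nat.ceil_le, hm]
    constructor
    · rintro ⟨h, h'⟩
      exact ⟨h, fun h'' => by omega⟩
    · rintro ⟨h, h'⟩
      exact ⟨h, by by_contra hlt; exact h' ⟨by omega, h.2⟩⟩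
  have hsdiff := Finset.sum_sdiff (f := fun p : ℕ => log (p : ℝ) / p) (Nat.primesLE_mono hmb)
  rw [hfilter]
  have h1 := sum_log_div_primesLE_le hfloor
  have h2 := hC m hm0
  have h3 := le_abs_self C
  linarith

open Real in
theorem exists_sum_one_div_primes_le :
    ∃ C : ℝ, 0 ≤ C ∧ ∀ a b : ℝ, 2 ≤ a → a ≤ b →
      ∑ p ∈ (Nat.primesLE ⌊b⌋₊).filter (fun p : ℕ => a ≤ (p : ℝ)), 1 / (p : ℝ) ≤
        (log b - log a + C) / log a := by
  obtain ⟨C, hC0, hC⟩ := exists_sum_log_div_le_log_sub_log_add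
  refine ⟨C, hC0, fun a b ha hab => ?_⟩
  have hla : 0 < log a := log_pos (by linarith)
  rw [le_div_iff₀ hla, Finset.sum_mul]
  refine (Finset.sum_le_sum fun p hp => ?_).trans (hC a b ha hab)
  rw [one_div_mul_eq_div]
  have := log_le_log (by linarith) (Finset.mem_filter.1 hp).2
  gcongr

theorem sum_one_div_primes_le_add (a b c : ℝ) :
    ∑ p ∈ (Nat.primesLE ⌊c⌋₊).filter (fun p : ℕ => a ≤ (p : ℝ)), 1 / (p : ℝ) ≤
      ∑ p ∈ (Nat.primesLE ⌊b⌋₊).filter (fun p : ℕ => a ≤ (p : ℝ)), 1 / (p : ℝ) +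
      ∑ p ∈ (Nat.primesLE ⌊c⌋₊).filter (fun p : ℕ => b ≤ (p : ℝ)), 1 / (p : ℝ) := by
  rw [← Finset.sum_union_inter]
  refine le_add_of_le_of_nonneg (Finset.sum_le_sum_of_subset_of_nonneg ?_ ?_)
    (Finset.sum_nonneg fun p _ => by positivity)
  · intro p hp
    simp only [Finset.mem_union, Finset.mem_filter, Nat.mem_primesLE] at hp ⊢
    rcases le_total b p with h | h
    · exact Or.inr ⟨hp.1, h⟩
    · exact Or.inl ⟨⟨Nat.le_floor h, hp.1.2⟩, hp.2⟩
  · intro p _ _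
    positivity

open Real in
theorem exists_sum_one_div_primes_rpow_le :
    ∃ C : ℝ, 0 ≤ C ∧ ∀ r y : ℝ, 1 ≤ r → 2 ≤ y → ∀ k : ℕ, 1 ≤ k →
      ∑ p ∈ (Nat.primesLE ⌊y ^ (r ^ k)⌋₊).filter (fun p : ℕ => y ≤ (p : ℝ)), 1 / (p : ℝ) ≤
        k * (r - 1 + C / log y) := by
  obtain ⟨C, hC0, hC⟩ := exists_sum_one_div_primes_le
  refine ⟨C, hC0, fun r y hr hy k hk => ?_⟩
  have hy0 : 0 < y := by linarith
  have hly : 0 < log y := log_pos (by linarith)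
  have step : ∀ j : ℕ, ∑ p ∈ (Nat.primesLE ⌊y ^ (r ^ (j + 1))⌋₊).filter
      (fun p : ℕ => y ^ (r ^ j) ≤ (p : ℝ)), 1 / (p : ℝ) ≤ r - 1 + C / log y := by
    intro j
    have hrj : 1 ≤ r ^ j := one_le_pow₀ hr
    have hge : y ≤ y ^ (r ^ j) := self_le_rpow_of_one_le (by linarith) hrj
    refine (hC _ _ (hy.trans hge) (rpow_le_rpow_of_exponent_le (by linarith)
      (pow_le_pow_right₀ hr j.le_succ))).trans ?_
    rw [log_rpow hy0, log_rpow hy0]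
    have hpos : 0 < r ^ j * log y := by positivity
    have heq : (r ^ (j + 1) * log y - r ^ j * log y + C) / (r ^ j * log y) =
        r - 1 + C / (r ^ j * log y) := by
      field_simp
      ring
    rw [heq]
    gcongr
    nlinarith
  induction k, hk using Nat.le_induction with
  | base => simpa using step 0
  | succ k hk ih =>
    refine (sum_one_div_primes_le_add y (y ^ (r ^ k)) _).trans ?_
    have := step k
    push_cast
    linarith

theorem sub_sum_one_div_primes_le_card_smooth {x : ℝ} (hx : 0 ≤ x) (y : ℝ) :
    x - 1 - x * ∑ p ∈ (Nat.primesLE ⌊x⌋₊).filter (fun p : ℕ => y ≤ (p : ℝ)), 1 / (p : ℝ) ≤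
      (((Finset.Icc 1 ⌊x⌋₊).filter
        (fun n => ∀ p : ℕ, p.Prime → p ∣ n → (p : ℝ) < y)).card : ℝ) := by
  set P := (Nat.primesLE ⌊x⌋₊).filter (fun p : ℕ => y ≤ (p : ℝ))
  have hcard := Finset.card_filter_add_card_filter_not (s := Finset.Icc 1 ⌊x⌋₊)
    (fun n => ∀ p : ℕ, p.Prime → p ∣ n → (p : ℝ) < y)
  rw [Nat.card_Icc, Nat.add_sub_cancel] at hcard
  have hsub : (Finset.Icc 1 ⌊x⌋₊).filter
      (fun n => ¬ ∀ p : ℕ, p.Prime → p ∣ n → (p : ℝ) < y) ⊆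
      P.biUnion fun p => (Finset.Ioc 0 ⌊x⌋₊).filter (fun n => p ∣ n) := by
    intro n hn
    simp only [Finset.mem_filter, Finset.mem_Icc] at hn
    obtain ⟨⟨h1, h2⟩, h3⟩ := hn
    push Not at h3
    obtain ⟨p, hp, hd, hle⟩ := h3
    simp only [P, Finset.mem_biUnion, Finset.mem_filter, Finset.mem_Ioc, Nat.mem_primesLE]
    exact ⟨p, ⟨⟨(Nat.le_of_dvd h1 hd).trans h2, hp⟩, hle⟩, ⟨h1, h2⟩, hd⟩
  have hbad := (Finset.card_le_card hsub).trans Finset.card_biUnion_le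
  simp only [Nat.Ioc_filter_dvd_card_eq_div] at hbad
  have hreal : ((∑ p ∈ P, ⌊x⌋₊ / p : ℕ) : ℝ) ≤ x * ∑ p ∈ P, 1 / (p : ℝ) := by
    rw [Nat.cast_sum, Finset.mul_sum]
    refine Finset.sum_le_sum fun p _ => Nat.cast_div_le.trans ?_
    rw [mul_one_div]
    gcongr
    exact Nat.floor_le hx
  have hfloor := Nat.lt_floor_add_one x
  have hcard' := congrArg (Nat.cast (R := ℝ)) hcard
  have hbad' := Nat.cast_le (α := ℝ).2 hbad
  rw [Nat.cast_add] at hcard'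
  linarith

open Real in
theorem exists_mul_exp_log_two_div_sub_one_lt {ε : ℝ} (hε : 0 < ε) :
    ∃ k : ℕ, 1 ≤ k ∧ k * (exp (log 2 / k) - 1) < log 2 + ε := by
  obtain ⟨k, hk⟩ := exists_nat_gt (1 / ε)
  have hk0 : (0 : ℝ) < k := (by positivity : 0 < 1 / ε).trans hk
  have hk1 : 1 ≤ k := by exact_mod_cast hk0
  refine ⟨k, hk1, ?_⟩
  have hl0 : 0 < log 2 := log_pos one_lt_two
  have hl1 : log 2 < 1 := log_two_lt_d9.trans (by norm_num)
  have hk1' : (1 : ℝ) ≤ k := by exact_mod_cast hk1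
  have hu : |log 2 / k| ≤ 1 := by
    rw [abs_of_pos (by positivity), div_le_one hk0]
    linarith
  have h := (le_abs_self _).trans (abs_exp_sub_one_sub_id_le hu)
  have hinv : 1 / (k : ℝ) < ε := by
    rw [div_lt_iff₀ hk0]
    rw [div_lt_iff₀ hε] at hk
    linarith
  calc k * (exp (log 2 / k) - 1) ≤ k * (log 2 / k + (log 2 / k) ^ 2) := by gcongr; linarith
    _ = log 2 + log 2 ^ 2 * (1 / k) := by field_simp
    _ ≤ log 2 + 1 * (1 / k) := by gcongr; nlinarith
    _ < log 2 + ε := by linarith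

/-- Any `0 < α < ln (e/2)` satisfies: for all sufficiently large `x`, the number of
integers `1 ≤ n ≤ x` all of whose prime divisors are smaller than `√x` exceeds `α x`. -/
theorem stmt_12 (α : ℝ) (hα : 0 < α) (hα' : α < Real.log (Real.exp 1 / 2)) :
    ∃ x₀ : ℝ, ∀ x : ℝ, x₀ < x →
      α * x < (((Finset.Icc 1 ⌊x⌋₊).filter
        (fun n => ∀ p : ℕ, p.Prime → p ∣ n → (p : ℝ) < Real.sqrt x)).card : ℝ) := by
  rw [Real.log_div (Real.exp_ne_zero 1) two_ne_zero, Real.log_exp] at hα'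
  obtain ⟨k, hk1, hk⟩ := exists_mul_exp_log_two_div_sub_one_lt
    (show 0 < 1 - Real.log 2 - α by linarith)
  obtain ⟨C, -, hC⟩ := exists_sum_one_div_primes_rpow_le
  set r := Real.exp (Real.log 2 / k)
  have hk0 : (k : ℝ) ≠ 0 := by exact_mod_cast (by omega : k ≠ 0)
  have hr : 1 ≤ r := Real.one_le_exp (by positivity)
  have hrk : r ^ k = 2 := by
    rw [← Real.exp_nat_mul, mul_div_cancel₀ _ hk0, Real.exp_log two_pos]
  have hlim : Filter.Tendsto (fun x : ℝ => α + x⁻¹ + k * (r - 1 + C / Real.log (Real.sqrt x)))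
      Filter.atTop (nhds (α + 0 + k * (r - 1 + 0))) :=
    (tendsto_const_nhds.add tendsto_inv_atTop_zero).add <| tendsto_const_nhds.mul <|
      tendsto_const_nhds.add <| tendsto_const_nhds.div_atTop <|
        Real.tendsto_log_atTop.comp Real.tendsto_sqrt_atTop
  have hev := hlim.eventually (gt_mem_nhds (show α + 0 + k * (r - 1 + 0) < 1 by linarith))
  obtain ⟨x₀, hx₀⟩ := Filter.eventually_atTop.1 (hev.and (Filter.eventually_ge_atTop 4))
  refine ⟨x₀, fun x hx => ?_⟩
  obtain ⟨hlt, hx4⟩ := hx₀ x hx.le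
  have hx0 : 0 < x := by linarith
  have hy : 2 ≤ Real.sqrt x := Real.le_sqrt_of_sq_le (by linarith)
  have hsum := hC r (Real.sqrt x) hr hy k hk1
  rw [hrk, Real.rpow_two, Real.sq_sqrt hx0.le] at hsum
  refine lt_of_lt_of_le ?_ (sub_sum_one_div_primes_le_card_smooth hx0.le (Real.sqrt x))
  have h1 := mul_le_mul_of_nonneg_left hsum hx0.le
  have h2 := mul_lt_mul_of_pos_left hlt hx0
  rw [mul_add, mul_add, mul_inv_cancel₀ hx0.ne'] at h2
  linarith
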